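/- Let X be a Banach two-sided ℍ-module, let D(A) be a right ℍ-submodule of X, and let A : D(A) → X be a closed right linear operator. Then S_q⁻¹(A) ∈ Lin^r(X) for every q ∈ ρ_S(A), and for all p, q ∈ ρ_S(A) the following resolvent equation holds: S_p⁻¹(A) − S_q⁻¹(A) = Q_q(A)(q − p) + Q_q(A) S_p⁻¹(A) Δ_q(p). -/

import Mathlib

open MulOpposite Filter Topology Classical

noncomputable section

notation "ℍ" => Quaternion ℝ

/-- A *Banach two-sided `ℍ`-module*: a two-sided `ℍ`-module (left `ℍ`-action, right
`ℍ`-action encoded as a left `ℍᵐᵒᵖ`-action) whose complete norm satisfies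
`‖qx‖ = ‖xq‖ = |q|‖x‖`, and where real scalars act the same on both sides. -/
class QuatBimodule (Y : Type*) [NormedAddCommGroup Y]
    [Module ℍ Y] [Module ℍᵐᵒᵖ Y] : Prop where
  smul_op_comm : ∀ (p q : ℍ) (y : Y), p • (op q • y) = op q • (p • y)
  norm_smul_left : ∀ (q : ℍ) (y : Y), ‖q • y‖ = ‖q‖ * ‖y‖
  norm_smul_right : ∀ (q : ℍ) (y : Y), ‖op q • y‖ = ‖q‖ * ‖y‖
  real_smul_comm : ∀ (r : ℝ) (y : Y), ((r : ℝ) : ℍ) • y = op ((r : ℝ) : ℍ) • y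

variable {X : Type*} [NormedAddCommGroup X] [Module ℍ X] [Module ℍᵐᵒᵖ X]

/-- Membership in `Lin^r(X)`: additive, right `ℍ`-linear, with finite operator
norm (i.e. `‖B x‖` is bounded on the closed unit ball). -/
def MemLinR (B : X → X) : Prop :=
  (∀ x y : X, B (x + y) = B x + B y) ∧
  (∀ (q : ℍ) (x : X), B (op q • x) = op q • B x) ∧
  BddAbove ((fun x : X => ‖B x‖) '' {x : X | ‖x‖ ≤ 1})

/-- The operator norm `‖B‖ = sup {‖B x‖ : ‖x‖ ≤ 1}`. -/
def opNorm (B : X → X) : ℝ :=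
  sSup ((fun x : X => ‖B x‖) '' {x : X | ‖x‖ ≤ 1})

/-- A right linear operator `A : D(A) → X`, where `D(A)` is a right `ℍ`-submodule
of `X`.  It is encoded as a function `X → X` together with its domain; only the
values on the domain are relevant. -/
structure RightLinearOp (X : Type*) [NormedAddCommGroup X]
    [Module ℍ X] [Module ℍᵐᵒᵖ X] where
  dom : Set X
  toFun : X → X
  zero_mem : (0 : X) ∈ dom
  add_mem : ∀ ⦃x⦄, x ∈ dom → ∀ ⦃y⦄, y ∈ dom → x + y ∈ dom
  neg_mem : ∀ ⦃x⦄, x ∈ dom → -x ∈ dom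
  smulR_mem : ∀ (q : ℍ) ⦃x⦄, x ∈ dom → op q • x ∈ dom
  map_add' : ∀ ⦃x⦄, x ∈ dom → ∀ ⦃y⦄, y ∈ dom → toFun (x + y) = toFun x + toFun y
  map_smulR' : ∀ (q : ℍ) ⦃x⦄, x ∈ dom → toFun (op q • x) = op q • toFun x

namespace RightLinearOp

variable (T : RightLinearOp X)

/-- `A` is closed: its graph is closed in `X × X`. -/
def IsClosedOp : Prop := IsClosed {p : X × X | p.1 ∈ T.dom ∧ T.toFun p.1 = p.2}

/-- The domain `D(A²)` of `A²`. -/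
def dom2 : Set X := {x | x ∈ T.dom ∧ T.toFun x ∈ T.dom}

/-- The operator `Δ_q(A) = A² − 2 Re(q) A + |q|² Id`, with domain `D(A²)`. -/
def delta (q : ℍ) (x : X) : X :=
  T.toFun (T.toFun x) - ((2 * q.re : ℝ) : ℍ) • T.toFun x + ((‖q‖ ^ 2 : ℝ) : ℍ) • x

/-- `B` is the inverse of `Δ_q(A) : D(A²) → X`, and `B ∈ Lin^r(X)`. -/
def IsQInv (q : ℍ) (B : X → X) : Prop :=
  MemLinR B ∧ (∀ x : X, B x ∈ T.dom2) ∧ (∀ x : X, T.delta q (B x) = x) ∧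
    ∀ x ∈ T.dom2, B (T.delta q x) = x

/-- The S-resolvent set `ρ_S(A)`. -/
def rhoS : Set ℍ := {q | ∃ B : X → X, T.IsQInv q B}

/-- `Q_q(A) = Δ_q(A)⁻¹ ∈ Lin^r(X)`, for `q ∈ ρ_S(A)` (junk value otherwise). -/
def qres (q : ℍ) : X → X :=
  if h : q ∈ T.rhoS then h.choose else fun _ => 0

/-- The (left) S-resolvent operator `S_q⁻¹(A) = Q_q(A) q̄ − A Q_q(A)`, where the
right scalar multiple of an operator is `(B q̄)(x) = B(q̄ x)`. -/
def sres (q : ℍ) : X → X :=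
  fun x => T.qres q (star q • x) - T.toFun (T.qres q x)

/-- The coefficients `B_n`: `B_{2k} = Q_{q0}(A)^k`, `B_{2k+1} = Q_{q0}(A)^k S_{q0}⁻¹(A)`. -/
def Bop (q0 : ℍ) (n : ℕ) : X → X :=
  if n % 2 = 0 then (T.qres q0)^[n / 2] else (T.qres q0)^[n / 2] ∘ T.sres q0

end RightLinearOp

/-- The quaternionic polynomial `Δ_q(p) = p² − 2 Re(q) p + |q|²`. -/
def deltaPoly (q p : ℍ) : ℍ :=
  p ^ 2 - ((2 * q.re : ℝ) : ℍ) * p + ((‖q‖ ^ 2 : ℝ) : ℍ)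

/-- The "powers" `p_{q0,n}`: `p_{q0,2k}(q) = Δ_{q0}(q)^k`,
`p_{q0,2k+1}(q) = (q − q0) Δ_{q0}(q)^k`. -/
def spow (q0 : ℍ) (n : ℕ) (q : ℍ) : ℍ :=
  if n % 2 = 0 then deltaPoly q0 q ^ (n / 2) else (q - q0) * deltaPoly q0 q ^ (n / 2)

/-- The Cassini pseudo-metric `u(p,q) = √|Δ_q(p)|`. -/
def cassini (p q : ℍ) : ℝ := Real.sqrt ‖deltaPoly q p‖

/-- The Cassini ball `U(q0,R)`. -/
def cassiniBall (q0 : ℍ) (R : ℝ) : Set ℍ := {p : ℍ | cassini p q0 < R}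

/-- The Cassini topology on `ℍ`: the topology induced by the Cassini pseudo-metric,
i.e. the topology generated by the Cassini balls. -/
def cassiniTopology : TopologicalSpace ℍ :=
  TopologicalSpace.generateFrom {U : Set ℍ | ∃ q0 R, 0 < R ∧ U = cassiniBall q0 R}

/-- The spherical derivative of a function `g : ℍ → ℍ`. -/
def sderivQ (g : ℍ → ℍ) (q : ℍ) : ℍ :=
  if q.im = 0 then deriv (fun t : ℝ => g ((t : ℝ) : ℍ)) q.re
  else (g q - g (star q)) * (q - star q)⁻¹

end

noncomputable section

variable {X : Type*} [NormedAddCommGroup X] [Module ℍ X] [Module ℍᵐᵒᵖ X]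

namespace QuatBimodule

variable [QuatBimodule X]

/-- The real normed space underlying a Banach two-sided quaternionic module. -/
abbrev realNormedSpace (Y : Type*) [NormedAddCommGroup Y]
    [Module ℍ Y] [Module ℍᵐᵒᵖ Y] [QuatBimodule Y] : NormedSpace ℝ Y :=
  { Module.compHom Y (algebraMap ℝ ℍ) with
    norm_smul_le := fun r y => by
      change ‖(algebraMap ℝ ℍ r) • y‖ ≤ _
      rw [norm_smul_left, norm_algebraMap'] }

theorem continuous_smul_left (q : ℍ) : Continuous fun x : X => q • x :=
  AddMonoidHomClass.continuous_of_bound (DistribSMul.toAddMonoidHom X q) ‖q‖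
    fun x => (norm_smul_left q x).le

/-- A right quaternionic linear map, viewed as a real linear map. -/
def toRealLinearMap (F : X → X) (hadd : ∀ x y, F (x + y) = F x + F y)
    (hsmul : ∀ (q : ℍ) (x : X), F (op q • x) = op q • F x) :
    letI := realNormedSpace X
    X →ₗ[ℝ] X :=
  letI := realNormedSpace X
  { toFun := F
    map_add' := hadd
    map_smul' := fun r x => by
      change F ((r : ℍ) • x) = (r : ℍ) • F x
      rw [real_smul_comm, hsmul, real_smul_comm] }

theorem memLinR_iff_continuous {F : X → X} (hadd : ∀ x y, F (x + y) = F x + F y)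
    (hsmul : ∀ (q : ℍ) (x : X), F (op q • x) = op q • F x) :
    MemLinR F ↔ Continuous F := by
  let := realNormedSpace X
  let L : X →ₗ[ℝ] X := toRealLinearMap F hadd hsmul
  constructor
  · rintro ⟨-, -, M, hM⟩
    have hball : ∀ z ∈ Metric.closedBall (0 : X) 1, ‖L z‖ ≤ M := fun z hz =>
      hM ⟨z, by simpa using hz, rfl⟩
    exact AddMonoidHomClass.continuous_of_bound L M fun x => by
      rcases eq_or_ne x 0 with rfl | hx
      · simp
      have hx' : 0 < ‖x‖ := norm_pos_iff.2 hx
      have h := hball (‖x‖⁻¹ • x) (by simp [norm_smul, hx'.ne'])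
      rw [map_smul, norm_smul, norm_inv, norm_norm, inv_mul_le_iff₀ hx'] at h
      rwa [mul_comm]
  · intro hF
    let C : X →L[ℝ] X := ⟨L, hF⟩
    refine ⟨hadd, hsmul, ‖C‖, ?_⟩
    rintro _ ⟨x, hx, rfl⟩
    exact C.unit_le_opNorm x hx

end QuatBimodule

theorem MemLinR.continuous [QuatBimodule X] {B : X → X} (hB : MemLinR B) : Continuous B :=
  (QuatBimodule.memLinR_iff_continuous hB.1 hB.2.1).1 hB

theorem MemLinR.map_sub {Y : Type*} [NormedAddCommGroup Y] [Module ℍᵐᵒᵖ Y] {B : Y → Y}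
    (hB : MemLinR B) (x y : Y) : B (x - y) = B x - B y :=
  _root_.map_sub (AddMonoidHom.mk' B hB.1) x y

theorem MemLinR.map_real_smul [QuatBimodule X] {B : X → X} (hB : MemLinR B) (r : ℝ) (x : X) :
    B ((r : ℍ) • x) = (r : ℍ) • B x := by
  rw [QuatBimodule.real_smul_comm, hB.2.1, QuatBimodule.real_smul_comm]

theorem deltaPoly_self (q : ℍ) : deltaPoly q q = 0 := by
  rw [deltaPoly, sq ‖q‖, ← Quaternion.normSq_eq_norm_mul_self, ← Quaternion.star_mul_self,
    Quaternion.star_eq_two_re_sub]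
  push_cast
  noncomm_ring

namespace RightLinearOp

variable {T : RightLinearOp X}

theorem isQInv_qres {q : ℍ} (hq : q ∈ T.rhoS) : T.IsQInv q (T.qres q) := by
  rw [qres, dif_pos hq]
  exact hq.choose_spec

theorem map_neg {x : X} (hx : x ∈ T.dom) : T.toFun (-x) = -T.toFun x := by
  have h0 : T.toFun 0 = 0 := by simpa using T.map_add' T.zero_mem T.zero_mem
  have h := T.map_add' (T.neg_mem hx) hx
  rw [neg_add_cancel, h0] at h
  exact eq_neg_of_add_eq_zero_left h.symm

theorem sub_mem {x y : X} (hx : x ∈ T.dom) (hy : y ∈ T.dom) : x - y ∈ T.dom := by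
  rw [sub_eq_add_neg]
  exact T.add_mem hx (T.neg_mem hy)

theorem map_sub {x y : X} (hx : x ∈ T.dom) (hy : y ∈ T.dom) :
    T.toFun (x - y) = T.toFun x - T.toFun y := by
  rw [sub_eq_add_neg, T.map_add' hx (T.neg_mem hy), map_neg hy, sub_eq_add_neg]

/-- `A B` is in `Lin^r(X)` when `A` is closed, `B ∈ Lin^r(X)`, and `B` maps into `D(A)`. -/
theorem IsClosedOp.memLinR_comp [CompleteSpace X] [QuatBimodule X] (hT : T.IsClosedOp)
    {B : X → X} (hB : MemLinR B) (hdom : ∀ x, B x ∈ T.dom) :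
    MemLinR fun x => T.toFun (B x) := by
  have hadd : ∀ x y, T.toFun (B (x + y)) = T.toFun (B x) + T.toFun (B y) := fun x y => by
    rw [hB.1, T.map_add' (hdom x) (hdom y)]
  have hsmul : ∀ (q : ℍ) x, T.toFun (B (op q • x)) = op q • T.toFun (B x) := fun q x => by
    rw [hB.2.1, T.map_smulR' q (hdom x)]
  rw [QuatBimodule.memLinR_iff_continuous hadd hsmul]
  let := QuatBimodule.realNormedSpace X
  refine (QuatBimodule.toRealLinearMap _ hadd hsmul).continuous_of_isClosed_graph ?_
  have h := hT.preimage (hB.continuous.prodMap continuous_id)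
  convert h using 1
  ext ⟨x, y⟩
  simp only [SetLike.mem_coe, LinearMap.mem_graph_iff, Set.mem_preimage, Set.mem_ofPred_eq,
    Prod.map, id_eq, hdom, true_and]
  exact eq_comm

theorem memLinR_sres [CompleteSpace X] [QuatBimodule X] (hT : T.IsClosedOp) {q : ℍ}
    (hq : q ∈ T.rhoS) : MemLinR (T.sres q) := by
  obtain ⟨hB, hdom, -, -⟩ := isQInv_qres hq
  have hAB := hT.memLinR_comp hB fun x => (hdom x).1
  refine (QuatBimodule.memLinR_iff_continuous (fun x y => ?_) fun r x => ?_).2 ?_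
  · simp only [sres, smul_add, hB.1, T.map_add' (hdom x).1 (hdom y).1]
    abel
  · simp only [sres, QuatBimodule.smul_op_comm, hB.2.1, T.map_smulR' r (hdom x).1, smul_sub]
  · exact (hB.continuous.comp (QuatBimodule.continuous_smul_left _)).sub hAB.continuous

theorem sres_mem_dom {q : ℍ} (hq : q ∈ T.rhoS) (x : X) : T.sres q x ∈ T.dom :=
  sub_mem ((isQInv_qres hq).2.1 _).1 ((isQInv_qres hq).2.1 x).2

/-- The identity `A S_q⁻¹(A) = S_q⁻¹(A) q - Id`. -/
theorem toFun_sres [QuatBimodule X] {q : ℍ} (hq : q ∈ T.rhoS) (x : X) :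
    T.toFun (T.sres q x) = T.sres q (q • x) - x := by
  obtain ⟨hB, hdom, hinv, -⟩ := isQInv_qres hq
  have hnorm : star q * q = ((‖q‖ ^ 2 : ℝ) : ℍ) := by
    rw [Quaternion.star_mul_self, Quaternion.normSq_eq_norm_mul_self, sq]
  have hstar : star q • x = ((2 * q.re : ℝ) : ℍ) • x - q • x := by
    rw [Quaternion.star_eq_two_re_sub, sub_smul]
  have hqx := hdom (q • x)
  have hrx := hdom (((2 * q.re : ℝ) : ℍ) • x)
  have hreal : T.toFun (T.qres q (((2 * q.re : ℝ) : ℍ) • x)) =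
      ((2 * q.re : ℝ) : ℍ) • T.toFun (T.qres q x) := by
    rw [hB.map_real_smul, QuatBimodule.real_smul_comm, T.map_smulR' _ (hdom x).1,
      QuatBimodule.real_smul_comm]
  have hdelta := hinv x
  rw [delta, ← eq_sub_iff_add_eq, sub_eq_iff_eq_add] at hdelta
  rw [sres, sres, map_sub (hdom _).1 (hdom x).2, smul_smul, hnorm, hB.map_real_smul, hstar,
    hB.map_sub, map_sub hrx.1 hqx.1, hreal, hdelta]
  abel

/-- `Δ_q(A) (S_p⁻¹(A) - S_q⁻¹(A)) = (q - p) Id + S_p⁻¹(A) Δ_q(p)`. -/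
theorem delta_sres_sub_sres [CompleteSpace X] [QuatBimodule X] (hT : T.IsClosedOp) {p q : ℍ}
    (hp : p ∈ T.rhoS) (hq : q ∈ T.rhoS) (x : X) :
    T.sres p x - T.sres q x ∈ T.dom2 ∧
      T.delta q (T.sres p x - T.sres q x) = (q - p) • x + T.sres p (deltaPoly q p • x) := by
  have hSp := memLinR_sres hT hp
  have hSq := memLinR_sres hT hq
  have hA : T.toFun (T.sres p x - T.sres q x) = T.sres p (p • x) - T.sres q (q • x) := by
    rw [map_sub (sres_mem_dom hp x) (sres_mem_dom hq x), toFun_sres hp, toFun_sres hq]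
    abel
  have hexpand : ∀ {S : X → X}, MemLinR S → ∀ r : ℍ, S (deltaPoly q r • x) =
      S (r • r • x) - ((2 * q.re : ℝ) : ℍ) • S (r • x) + ((‖q‖ ^ 2 : ℝ) : ℍ) • S x := by
    intro S hS r
    rw [deltaPoly, add_smul, sub_smul, hS.1, hS.map_sub, hS.map_real_smul, sq r, mul_smul,
      mul_smul, hS.map_real_smul]
  have hzero := hexpand hSq q
  rw [deltaPoly_self, zero_smul, ← sub_self (0 : X), hSq.map_sub, sub_self] at hzero
  refine ⟨⟨sub_mem (sres_mem_dom hp x) (sres_mem_dom hq x), ?_⟩, ?_⟩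
  · rw [hA]
    exact sub_mem (sres_mem_dom hp _) (sres_mem_dom hq _)
  · rw [delta, hA, map_sub (sres_mem_dom hp _) (sres_mem_dom hq _), toFun_sres hp,
      toFun_sres hq, hexpand hSp p, ← sub_eq_zero, ← neg_eq_zero, hzero, sub_smul, smul_sub,
      smul_sub]
    abel

end RightLinearOp

end

/-- Resolvent equation, Theorem `T:resolv.eq.`:
`S_q⁻¹(A) ∈ Lin^r(X)` for every `q ∈ ρ_S(A)`, and for all `p, q ∈ ρ_S(A)`,
`S_p⁻¹(A) − S_q⁻¹(A) = Q_q(A)(q − p) + Q_q(A) S_p⁻¹(A) Δ_q(p)` (equality of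
operators on `X`; a right quaternionic scalar `c` of an operator `B` acts by
`(B c)(x) = B (c x)`). -/
theorem stmt0 {X : Type*} [NormedAddCommGroup X] [CompleteSpace X]
    [Module ℍ X] [Module ℍᵐᵒᵖ X] [QuatBimodule X]
    (T : RightLinearOp X) (hT : T.IsClosedOp) :
    (∀ q ∈ T.rhoS, MemLinR (T.sres q)) ∧
    (∀ p ∈ T.rhoS, ∀ q ∈ T.rhoS, ∀ x : X,
      T.sres p x - T.sres q x =
        T.qres q ((q - p) • x) + T.qres q (T.sres p (deltaPoly q p • x))) := by
  refine ⟨fun q hq => RightLinearOp.memLinR_sres hT hq, fun p hp q hq x => ?_⟩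
  obtain ⟨hmem, hdelta⟩ := RightLinearOp.delta_sres_sub_sres hT hp hq x
  obtain ⟨hQ, -, -, hleft⟩ := RightLinearOp.isQInv_qres hq
  rw [← hleft _ hmem, hdelta, hQ.1]
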